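/- Let n ≥ 4 be an even natural number. Then M(P_n × P_n) ∈ {n³ − 3, n³ − 2}; that is, McNeil's conjectured value n³ − 3 for M(P_n²) is correct up to an additive constant of 1. -/

import Mathlib

/-- The Manhattan distance between two vertices of the grid graph `P_m × P_n`. -/
def gridDist {m n : ℕ} (p q : Fin m × Fin n) : ℕ :=
  Nat.dist p.1 q.1 + Nat.dist p.2 q.2

/-- The length of the walk induced by a labeling (bijection) `σ` of the vertices of
`P_m × P_n` by `{1, …, mn}`: the sum of Manhattan distances between consecutively
labeled vertices. -/
def walkLen (m n : ℕ) (σ : Fin m × Fin n ≃ Fin (m * n)) : ℕ :=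
  ∑ t : Fin (m * n - 1),
    gridDist (σ.symm (t.castLE (by omega))) (σ.symm ⟨t.val + 1, by omega⟩)

/-- `M(P_m × P_n)`: the maximal length of a walk induced by a labeling of `P_m × P_n`. -/
noncomputable def maxWalk (m n : ℕ) : ℕ := sSup (Set.range (walkLen m n))

/-- Twice the Manhattan distance from a vertex to the centre of the grid. -/
def centerDist {n : ℕ} (p : Fin n × Fin n) : ℕ :=
  Nat.dist (2 * p.1 + 1) n + Nat.dist (2 * p.2 + 1) n

theorem two_mul_gridDist_le {n : ℕ} (p q : Fin n × Fin n) :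
    2 * gridDist p q ≤ centerDist p + centerDist q := by
  simp only [gridDist, centerDist, Nat.dist]
  omega

theorem two_le_centerDist {n : ℕ} (hne : Even n) (p : Fin n × Fin n) : 2 ≤ centerDist p := by
  obtain ⟨k, rfl⟩ := hne
  simp only [centerDist, Nat.dist]
  omega

theorem sum_dist_center (k : ℕ) :
    ∑ i : Fin (k + k), Nat.dist (2 * i + 1) (k + k) = k * (k + k) := by
  rw [Fin.sum_univ_eq_sum_range (fun i => Nat.dist (2 * i + 1) (k + k)), Finset.sum_range_add,
    ← Finset.sum_add_distrib, Finset.sum_congr rfl (g := fun _ => k + k)]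
  · simp
  · intro i hi
    have := Finset.mem_range.1 hi
    simp only [Nat.dist]
    omega

theorem sum_centerDist {n : ℕ} (hne : Even n) : ∑ p : Fin n × Fin n, centerDist p = n ^ 3 := by
  obtain ⟨k, rfl⟩ := hne
  simp only [centerDist, Fintype.sum_prod_type, Finset.sum_add_distrib, sum_dist_center,
    Finset.sum_const, Finset.card_univ, Fintype.card_fin, smul_eq_mul, ← Finset.mul_sum]
  ring

theorem sum_consecutive_add_ends {N : ℕ} (hN : 0 < N) (F : Fin N → ℕ) :
    ∑ t : Fin (N - 1), (F (t.castLE (by omega)) + F ⟨t.val + 1, by omega⟩)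
      + F ⟨0, hN⟩ + F ⟨N - 1, by omega⟩ = 2 * ∑ t, F t := by
  obtain ⟨N, rfl⟩ : ∃ M, N = M + 1 := ⟨N - 1, by omega⟩
  have h₁ := Fin.sum_univ_succ F
  have h₂ := Fin.sum_univ_castSucc F
  rw [Finset.sum_add_distrib]
  change ∑ t : Fin N, F t.castSucc + ∑ t : Fin N, F t.succ + F 0 + F (Fin.last N) = _
  omega

theorem sum_centerDist_consecutive {n : ℕ} (hn : 0 < n) (hne : Even n)
    (σ : Fin n × Fin n ≃ Fin (n * n)) :
    ∑ t : Fin (n * n - 1), (centerDist (σ.symm (t.castLE (by omega)))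
        + centerDist (σ.symm ⟨t.val + 1, by omega⟩))
      + centerDist (σ.symm ⟨0, Nat.mul_pos hn hn⟩)
      + centerDist (σ.symm ⟨n * n - 1, Nat.sub_lt (Nat.mul_pos hn hn) one_pos⟩) = 2 * n ^ 3 := by
  rw [← sum_centerDist hne, ← Equiv.sum_comp σ.symm]
  exact sum_consecutive_add_ends (Nat.mul_pos hn hn) fun t => centerDist (σ.symm t)

theorem walkLen_square_le {n : ℕ} (hn : 0 < n) (hne : Even n) (σ : Fin n × Fin n ≃ Fin (n * n)) :
    walkLen n n σ ≤ n ^ 3 - 2 := by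
  have h := sum_centerDist_consecutive hn hne σ
  have h₀ := two_le_centerDist hne (σ.symm ⟨0, Nat.mul_pos hn hn⟩)
  have h₁ := two_le_centerDist hne
    (σ.symm ⟨n * n - 1, Nat.sub_lt (Nat.mul_pos hn hn) one_pos⟩)
  have h₂ := Finset.sum_le_sum fun (t : Fin (n * n - 1)) (_ : t ∈ Finset.univ) =>
    two_mul_gridDist_le (σ.symm (t.castLE (by omega))) (σ.symm ⟨t.val + 1, by omega⟩)
  rw [← Finset.mul_sum] at h₂
  rw [walkLen]
  omega

/-- A walk on the `2k × 2k` grid that alternates between two opposite quadrants, starting and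
ending next to the centre, and then alternates between the other two quadrants, again ending next
to the centre. -/
def alternatingWalk (k t : ℕ) : ℕ × ℕ :=
  let a := t % (2 * (k * k)) / 2 / k
  let b := t % (2 * (k * k)) / 2 % k
  if t < 2 * (k * k) then
    if t % 2 = 0 then (k - 1 - a, k - 1 - b) else (2 * k - 1 - a, 2 * k - 1 - b)
  else
    if t % 2 = 0 then (k + a, b) else (a, 2 * k - 1 - b)

theorem mod_half_div_lt {k : ℕ} (hk : 0 < k) (t : ℕ) : t % (2 * (k * k)) / 2 / k < k := by
  have h := Nat.mod_lt t (show 0 < 2 * (k * k) by positivity)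
  rw [Nat.div_lt_iff_lt_mul hk]
  omega

theorem alternatingWalk_lt {k : ℕ} (hk : 0 < k) (t : ℕ) :
    (alternatingWalk k t).1 < k + k ∧ (alternatingWalk k t).2 < k + k := by
  have ha := mod_half_div_lt hk t
  have hb := Nat.mod_lt (t % (2 * (k * k)) / 2) hk
  unfold alternatingWalk
  dsimp only
  generalize t % (2 * (k * k)) / 2 / k = a at *
  generalize t % (2 * (k * k)) / 2 % k = b at *
  split_ifs <;> constructor <;> dsimp only <;> omega

theorem alternatingWalk_inj {k : ℕ} (hk : 0 < k) {s t : ℕ} (hs : s < 4 * (k * k))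
    (ht : t < 4 * (k * k)) (h : alternatingWalk k s = alternatingWalk k t) : s = t := by
  have ha := mod_half_div_lt hk t
  have hb := Nat.mod_lt (t % (2 * (k * k)) / 2) hk
  have ha' := mod_half_div_lt hk s
  have hb' := Nat.mod_lt (s % (2 * (k * k)) / 2) hk
  have hq := Nat.div_add_mod (t % (2 * (k * k)) / 2) k
  have hq' := Nat.div_add_mod (s % (2 * (k * k)) / 2) k
  have hr : t % (2 * (k * k)) = if t < 2 * (k * k) then t else t - 2 * (k * k) := by
    split_ifs with h
    · exact Nat.mod_eq_of_lt h
    · rw [Nat.mod_eq_sub_mod (by omega), Nat.mod_eq_of_lt (by omega)]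
  have hr' : s % (2 * (k * k)) = if s < 2 * (k * k) then s else s - 2 * (k * k) := by
    split_ifs with h
    · exact Nat.mod_eq_of_lt h
    · rw [Nat.mod_eq_sub_mod (by omega), Nat.mod_eq_of_lt (by omega)]
  unfold alternatingWalk at h
  dsimp only at h
  generalize t % (2 * (k * k)) = r at *
  generalize s % (2 * (k * k)) = r' at *
  generalize k * k = K at *
  have key : r / 2 / k = r' / 2 / k → r / 2 % k = r' / 2 % k → r / 2 = r' / 2 := by
    intro e₁ e₂
    rw [← hq, ← hq', e₁, e₂]
  generalize r / 2 / k = a at *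
  generalize r / 2 % k = b at *
  generalize r' / 2 / k = a' at *
  generalize r' / 2 % k = b' at *
  clear hq hq'
  split_ifs at h hr hr' <;> rw [Prod.mk.injEq] at h <;> omega

theorem exists_alternatingWalk_labeling {k : ℕ} (hk : 0 < k) :
    ∃ σ : Fin (k + k) × Fin (k + k) ≃ Fin ((k + k) * (k + k)),
      ∀ t, ((σ.symm t).1 : ℕ) = (alternatingWalk k t).1 ∧
        ((σ.symm t).2 : ℕ) = (alternatingWalk k t).2 := by
  let f : Fin ((k + k) * (k + k)) → Fin (k + k) × Fin (k + k) := fun t =>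
    (⟨_, (alternatingWalk_lt hk t).1⟩, ⟨_, (alternatingWalk_lt hk t).2⟩)
  have hf : Function.Bijective f := by
    refine (Fintype.bijective_iff_injective_and_card f).2 ⟨fun s t h => ?_, by simp⟩
    have e : (k + k) * (k + k) = 4 * (k * k) := by ring
    simp only [f, Prod.mk.injEq, Fin.mk.injEq] at h
    exact Fin.ext (alternatingWalk_inj hk (e ▸ s.2) (e ▸ t.2) (Prod.ext h.1 h.2))
  exact ⟨(Equiv.ofBijective f hf).symm, fun t => ⟨rfl, rfl⟩⟩

theorem alternatingWalk_zero (k : ℕ) (hk : 0 < k) : alternatingWalk k 0 = (k - 1, k - 1) := by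
  simp [alternatingWalk, hk]

theorem sq_sub_one_div_mod {k : ℕ} (hk : 0 < k) :
    (k * k - 1) / k = k - 1 ∧ (k * k - 1) % k = k - 1 := by
  obtain ⟨m, rfl⟩ : ∃ m, k = m + 1 := ⟨k - 1, by omega⟩
  have e : (m + 1) * (m + 1) - 1 = m + (m + 1) * m := by
    rw [Nat.sub_eq_of_eq_add]; ring
  rw [e, Nat.add_mul_div_left _ _ hk, Nat.add_mul_mod_self_left, Nat.div_eq_of_lt (by omega),
    Nat.mod_eq_of_lt (by omega)]
  omega

theorem alternatingWalk_half_sub_one {k : ℕ} (hk : 0 < k) :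
    alternatingWalk k (2 * (k * k) - 1) = (k, k) := by
  have hK : 0 < k * k := Nat.mul_pos hk hk
  obtain ⟨ha, hb⟩ := sq_sub_one_div_mod hk
  unfold alternatingWalk
  dsimp only
  rw [Nat.mod_eq_of_lt (b := 2 * (k * k)) (by omega), show (2 * (k * k) - 1) / 2 = k * k - 1 by omega, ha, hb,
    if_pos (by omega), if_neg (by omega), Prod.mk.injEq]
  omega

theorem alternatingWalk_half {k : ℕ} : alternatingWalk k (2 * (k * k)) = (k, 0) := by
  simp [alternatingWalk]

theorem alternatingWalk_last {k : ℕ} (hk : 0 < k) :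
    alternatingWalk k (4 * (k * k) - 1) = (k - 1, k) := by
  have hK : 0 < k * k := Nat.mul_pos hk hk
  obtain ⟨ha, hb⟩ := sq_sub_one_div_mod hk
  unfold alternatingWalk
  dsimp only
  rw [Nat.mod_eq_sub_mod (b := 2 * (k * k)) (by omega),
    Nat.mod_eq_of_lt (b := 2 * (k * k)) (by omega),
    show (4 * (k * k) - 1 - 2 * (k * k)) / 2 = k * k - 1 by omega, ha, hb,
    if_neg (by omega), if_neg (by omega), Prod.mk.injEq]
  omega

/-- Consecutive vertices of the walk lie in opposite quadrants, except at the single change of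
quadrant pair. -/
theorem alternatingWalk_opposite {k : ℕ} (hk : 0 < k) {t : ℕ} (ht : t + 1 ≠ 2 * (k * k)) :
    ((alternatingWalk k t).1 < k ↔ k ≤ (alternatingWalk k (t + 1)).1) ∧
      ((alternatingWalk k t).2 < k ↔ k ≤ (alternatingWalk k (t + 1)).2) := by
  have ha := mod_half_div_lt hk t
  have hb := Nat.mod_lt (t % (2 * (k * k)) / 2) hk
  have ha' := mod_half_div_lt hk (t + 1)
  have hb' := Nat.mod_lt ((t + 1) % (2 * (k * k)) / 2) hk
  unfold alternatingWalk
  dsimp only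
  generalize t % (2 * (k * k)) / 2 / k = a at *
  generalize t % (2 * (k * k)) / 2 % k = b at *
  generalize (t + 1) % (2 * (k * k)) / 2 / k = a' at *
  generalize (t + 1) % (2 * (k * k)) / 2 % k = b' at *
  generalize k * k = K at *
  split_ifs <;> dsimp only <;> omega

theorem exists_walkLen_square_ge {n : ℕ} (hn : 0 < n) (hne : Even n) :
    ∃ σ, n ^ 3 - 3 ≤ walkLen n n σ := by
  obtain ⟨k, rfl⟩ := id hne
  have hk : 0 < k := by omega
  have hK : 0 < k * k := Nat.mul_pos hk hk
  have e : (k + k) * (k + k) = 4 * (k * k) := by ring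
  obtain ⟨σ, hσ⟩ := exists_alternatingWalk_labeling hk
  refine ⟨σ, ?_⟩
  have h := sum_centerDist_consecutive hn hne σ
  have h₀ : centerDist (σ.symm ⟨0, Nat.mul_pos hn hn⟩) = 2 := by
    simp only [centerDist, hσ, alternatingWalk_zero k hk, Nat.dist]
    omega
  have h₁ : centerDist
      (σ.symm ⟨(k + k) * (k + k) - 1, Nat.sub_lt (Nat.mul_pos hn hn) one_pos⟩) = 2 := by
    simp only [centerDist, hσ, e, alternatingWalk_last hk, Nat.dist]
    omega
  have step : ∀ t : Fin ((k + k) * (k + k) - 1),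
      centerDist (σ.symm (t.castLE (by omega))) + centerDist (σ.symm ⟨t.val + 1, by omega⟩) ≤
        2 * gridDist (σ.symm (t.castLE (by omega))) (σ.symm ⟨t.val + 1, by omega⟩)
          + if t = ⟨2 * (k * k) - 1, by omega⟩ then 2 else 0 := by
    intro t
    simp only [centerDist, gridDist, hσ, Fin.val_castLE, Fin.ext_iff]
    split_ifs with ht
    · rw [ht, Nat.sub_add_cancel (by omega), alternatingWalk_half_sub_one hk,
        alternatingWalk_half]
      simp only [Nat.dist]
      omega
    · have ho := alternatingWalk_opposite hk (t := t) (by omega)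
      simp only [Nat.dist]
      omega
  have hs := Finset.sum_le_sum fun t (_ : t ∈ Finset.univ) => step t
  simp only [Finset.sum_add_distrib, ← Finset.mul_sum, Finset.sum_ite_eq', Finset.mem_univ,
    if_true] at h hs
  rw [walkLen]
  omega

theorem maxWalk_square_even (n : ℕ) (hn : 4 ≤ n) (hne : Even n) :
    maxWalk n n ∈ ({n ^ 3 - 3, n ^ 3 - 2} : Set ℕ) := by
  have hpos : 0 < n := by omega
  have hub : ∀ x ∈ Set.range (walkLen n n), x ≤ n ^ 3 - 2 :=
    Set.forall_mem_range.2 (walkLen_square_le hpos hne)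
  obtain ⟨σ, hσ⟩ := exists_walkLen_square_ge hpos hne
  have h₁ : maxWalk n n ≤ n ^ 3 - 2 := csSup_le ⟨_, σ, rfl⟩ hub
  have h₂ : walkLen n n σ ≤ maxWalk n n := le_csSup ⟨_, hub⟩ ⟨σ, rfl⟩
  rw [Set.mem_insert_iff, Set.mem_singleton_iff]
  omega
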